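/- arXiv:1411.3610 — 2 statements merged into one kernel-verified Lean document; each statement's English description precedes it below -/
import Mathlib

section
/- Let n ≥ 4 and ρ = (n−1)/2. Let k, l ∈ ℕ with k > l, and let α = (α₁,α₂,α₃) ∈ ℂ³ satisfy α₁+α₂+α₃ = −2(n−1)−2k and α₁+α₂ = −2(n−1)−2l. Then either α ∈ Z, or there exists (a₁,a₂,a₃) ∈ ℕ³ with I_α(a₁,a₂,a₃) ≠ 0. -/
open Polynomial

/-- `ρ = (n-1)/2` as a complex number. -/
noncomputable def rhoC (n : ℕ) : ℂ := ((n : ℂ) - 1) / 2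

/-- The Pochhammer symbol `(z)_m = z(z+1)⋯(z+m-1)`. -/
noncomputable def poch (z : ℂ) (m : ℕ) : ℂ := (ascPochhammer ℂ m).eval z

/-- `I_α(a₁,a₂,a₃)`, the value of the normalized trilinear form `K̃_α` on the invariant
polynomial `p_{a₁,a₂,a₃}(x,y,z) = |x−y|^{2a₃}|y−z|^{2a₁}|z−x|^{2a₂}`. -/
noncomputable def Ival (n : ℕ) (α₁ α₂ α₃ : ℂ) (a₁ a₂ a₃ : ℕ) : ℂ :=
  (((Real.pi / 2) ^ (3 * ((n : ℝ) - 1) / 2) : ℝ) : ℂ) *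
    (2 : ℂ) ^ (α₁ + α₂ + α₃ + 2 * ((a₁ : ℂ) + (a₂ : ℂ) + (a₃ : ℂ))) *
    poch ((α₁ + α₂ + α₃) / 2 + 2 * rhoC n) (a₁ + a₂ + a₃) *
    poch (α₁ / 2 + rhoC n) a₁ * poch (α₂ / 2 + rhoC n) a₂ * poch (α₃ / 2 + rhoC n) a₃ /
    (Complex.Gamma ((α₁ + α₂) / 2 + 2 * rhoC n + (a₁ : ℂ) + (a₂ : ℂ)) *
      Complex.Gamma ((α₂ + α₃) / 2 + 2 * rhoC n + (a₂ : ℂ) + (a₃ : ℂ)) *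
      Complex.Gamma ((α₃ + α₁) / 2 + 2 * rhoC n + (a₃ : ℂ) + (a₁ : ℂ)))

/-- The zero set `Z` of the normalized family, in the geometric parameter. -/
def memZ (n : ℕ) (α₁ α₂ α₃ : ℂ) : Prop :=
  (∃ i j : Fin 3, i ≠ j ∧
    (∃ k : ℕ, ![α₁, α₂, α₃] i = -((n : ℂ) - 1) - 2 * k) ∧
    (∃ k : ℕ, ![α₁, α₂, α₃] j = -((n : ℂ) - 1) - 2 * k)) ∨
  ((∃ k : ℕ, α₁ + α₂ + α₃ = -2 * ((n : ℂ) - 1) - 2 * k) ∧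
    (∃ i : Fin 3, ∃ l : ℕ, ![α₁, α₂, α₃] i = 2 * (l : ℂ)))

theorem poch_ne_zero {z : ℂ} {m : ℕ} (h : ∀ j : ℕ, j < m → z ≠ -j) : poch z m ≠ 0 := by
  rw [poch, Ne, ascPochhammer_eval_eq_zero_iff]
  rintro ⟨j, hj, hz⟩
  exact h j hj (by rw [hz, neg_neg])

/-- Sufficient conditions, factor by factor, for `I_α(a₁,a₂,a₃)` not to vanish. -/
theorem Ival_ne_zero {n : ℕ} {α₁ α₂ α₃ : ℂ} {a₁ a₂ a₃ : ℕ}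
    (h : ∀ j : ℕ, j < a₁ + a₂ + a₃ → (α₁ + α₂ + α₃) / 2 + 2 * rhoC n ≠ -j)
    (h₁ : ∀ j : ℕ, j < a₁ → α₁ / 2 + rhoC n ≠ -j)
    (h₂ : ∀ j : ℕ, j < a₂ → α₂ / 2 + rhoC n ≠ -j)
    (h₃ : ∀ j : ℕ, j < a₃ → α₃ / 2 + rhoC n ≠ -j)
    (h₁₂ : ∀ j : ℕ, (α₁ + α₂) / 2 + 2 * rhoC n + (a₁ : ℂ) + (a₂ : ℂ) ≠ -j)
    (h₂₃ : ∀ j : ℕ, (α₂ + α₃) / 2 + 2 * rhoC n + (a₂ : ℂ) + (a₃ : ℂ) ≠ -j)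
    (h₃₁ : ∀ j : ℕ, (α₃ + α₁) / 2 + 2 * rhoC n + (a₃ : ℂ) + (a₁ : ℂ) ≠ -j) :
    Ival n α₁ α₂ α₃ a₁ a₂ a₃ ≠ 0 := by
  have hpi : (((Real.pi / 2) ^ (3 * ((n : ℝ) - 1) / 2) : ℝ) : ℂ) ≠ 0 :=
    Complex.ofReal_ne_zero.2 (Real.rpow_pos_of_pos (by positivity) _).ne'
  have htwo : (2 : ℂ) ^ (α₁ + α₂ + α₃ + 2 * ((a₁ : ℂ) + (a₂ : ℂ) + (a₃ : ℂ))) ≠ 0 := by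
    simp [Complex.cpow_eq_zero_iff]
  exact div_ne_zero
    (mul_ne_zero (mul_ne_zero (mul_ne_zero (mul_ne_zero (mul_ne_zero hpi htwo)
      (poch_ne_zero h)) (poch_ne_zero h₁)) (poch_ne_zero h₂)) (poch_ne_zero h₃))
    (mul_ne_zero (mul_ne_zero (Complex.Gamma_ne_zero h₁₂) (Complex.Gamma_ne_zero h₂₃))
      (Complex.Gamma_ne_zero h₃₁))

/-- The conditions on `(a₁,a₂,a₃)` for `I_α(a₁,a₂,a₃) ≠ 0` when `α₁ + n - 1 = B` and
`α₂ + n - 1 = C` are integers and `α₃ = 2 (l - k)`. -/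
def IsAdmissible (N k l B C : ℤ) (a₁ a₂ a₃ : ℕ) : Prop :=
  l + 1 ≤ a₁ + a₂ ∧ (a₁ + a₂ + a₃ : ℤ) ≤ k ∧
  (∀ j : ℕ, j < a₁ → B ≠ -2 * j) ∧ (∀ j : ℕ, j < a₂ → C ≠ -2 * j) ∧
  (∀ j : ℕ, j < a₃ → N + 2 * (l - k) ≠ -2 * j) ∧
  (∀ j : ℕ, C + 2 * (l - k) + N + 2 * (a₂ + a₃) ≠ -2 * j) ∧
  (∀ j : ℕ, B + 2 * (l - k) + N + 2 * (a₁ + a₃) ≠ -2 * j)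

theorem IsAdmissible.swap {N k l B C : ℤ} {a₁ a₂ a₃ : ℕ}
    (h : IsAdmissible N k l B C a₁ a₂ a₃) : IsAdmissible N k l C B a₂ a₁ a₃ := by
  obtain ⟨h₁, h₂, h₃, h₄, h₅, h₆, h₇⟩ := h
  exact ⟨by omega, by omega, h₄, h₃, h₅, h₇, h₆⟩

theorem exists_isAdmissible_of_even {N B C : ℤ} {k l : ℕ} (hN : 0 < N) (hkl : l < k)
    (hBC : B + C = -2 * l) (hB : Even B) (hC : 0 < C)
    (hCN : ∀ j : ℕ, C ≠ N + 2 * j)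
    (hB3 : ∀ i j : ℕ, B = -2 * i → N + 2 * ((l : ℤ) - k) ≠ -2 * j) :
    ∃ a₁ a₂ a₃ : ℕ, IsAdmissible N k l B C a₁ a₂ a₃ := by
  obtain ⟨b, rfl⟩ := hB
  refine ⟨l + 1, 0, k - l - 1, by omega, by omega, fun j hj => by omega, fun j hj => by omega,
    fun j hj => hB3 (-b).toNat j (by omega), fun j hj => ?_, fun j hj => ?_⟩
  · omega
  · exact hCN j (by omega)

theorem exists_isAdmissible {N B C : ℤ} {k l : ℕ} (hN : 3 ≤ N) (hkl : l < k)
    (hBC : B + C = -2 * l)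
    (hBN : ∀ j : ℕ, B ≠ N + 2 * j) (hCN : ∀ j : ℕ, C ≠ N + 2 * j)
    (h12 : ∀ i j : ℕ, B = -2 * i → C ≠ -2 * j)
    (hB3 : ∀ i j : ℕ, B = -2 * i → N + 2 * ((l : ℤ) - k) ≠ -2 * j)
    (hC3 : ∀ i j : ℕ, C = -2 * i → N + 2 * ((l : ℤ) - k) ≠ -2 * j) :
    ∃ a₁ a₂ a₃ : ℕ, IsAdmissible N k l B C a₁ a₂ a₃ := by
  rcases Int.even_or_odd B with hB | hB
  · have hC : Even C := by
      rw [show C = -2 * l - B by omega]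
      exact (even_neg_two.mul_right _).sub hB
    rcases lt_or_ge 0 C with hC0 | hC0
    · exact exists_isAdmissible_of_even (by omega) hkl hBC hB hC0 hCN hB3
    rcases lt_or_ge 0 B with hB0 | hB0
    · obtain ⟨a₁, a₂, a₃, h⟩ :=
        exists_isAdmissible_of_even (by omega) hkl ((add_comm C B).trans hBC) hC hB0 hBN hC3
      exact ⟨a₂, a₁, a₃, h.swap⟩
    · obtain ⟨b, rfl⟩ := hB
      obtain ⟨c, rfl⟩ := hC
      exact (h12 (-b).toNat (-c).toNat (by omega) (by omega)).elim
  · obtain ⟨b, rfl⟩ := hB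
    rcases Int.even_or_odd N with ⟨r, rfl⟩ | ⟨r, rfl⟩
    · exact ⟨l + 1, 0, 0, by omega, by omega, fun j hj => by omega, fun j hj => by omega,
        fun j hj => by omega, fun j hj => by omega, fun j hj => by omega⟩
    · have hb : b < r := by
        by_contra! hb
        exact hBN (b - r).toNat (by omega)
      have hc : -l - b - 1 < r := by
        by_contra! hc
        exact hCN (-l - b - 1 - r).toNat (by omega)
      obtain ⟨a₁, a₂, ha, h₁, h₂⟩ : ∃ a₁ a₂ : ℕ, a₁ + a₂ = l + 1 ∧
          (a₁ : ℤ) < r - b ∧ (a₂ : ℤ) < r - (-l - b - 1) := by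
        refine ⟨min (r - b - 1).toNat (l + 1), l + 1 - min (r - b - 1).toNat (l + 1), ?_, ?_, ?_⟩ <;>
          omega
      exact ⟨a₁, a₂, k - l - 1, by omega, by omega, fun j hj => by omega, fun j hj => by omega,
        fun j hj => by omega, fun j hj => by omega, fun j hj => by omega⟩

theorem IsAdmissible.Ival_ne_zero {n k l : ℕ} {α₁ α₂ α₃ : ℂ} {B C : ℤ} {a₁ a₂ a₃ : ℕ}
    (h : IsAdmissible (n - 1) k l B C a₁ a₂ a₃) (hBC : B + C = -2 * l)
    (h₁ : α₁ = B - ((n : ℂ) - 1)) (h₂ : α₂ = C - ((n : ℂ) - 1))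
    (h₃ : α₃ = 2 * ((l : ℂ) - k)) :
    Ival n α₁ α₂ α₃ a₁ a₂ a₃ ≠ 0 := by
  obtain ⟨hl, hk, hB, hC, hA, hCA, hBA⟩ := h
  have hBC' : (B : ℂ) + C = -2 * l := by exact_mod_cast hBC
  subst h₁ h₂ h₃
  apply _root_.Ival_ne_zero
  · intro j hj e
    have : -(k : ℂ) = -(j : ℂ) := by
      rw [← e, rhoC]; linear_combination -hBC' / 2
    have : k = j := by exact_mod_cast neg_injective this
    omega
  · intro j hj e
    refine hB j hj ?_
    have : (B : ℂ) = -2 * j := by rw [rhoC] at e; linear_combination 2 * e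
    exact_mod_cast this
  · intro j hj e
    refine hC j hj ?_
    have : (C : ℂ) = -2 * j := by rw [rhoC] at e; linear_combination 2 * e
    exact_mod_cast this
  · intro j hj e
    refine hA j hj ?_
    have : ((n : ℂ) - 1) + 2 * (l - k) = -2 * j := by rw [rhoC] at e; linear_combination 2 * e
    exact_mod_cast this
  · intro j e
    have : (a₁ : ℂ) + a₂ + j = l := by rw [rhoC] at e; linear_combination e - hBC' / 2
    have : a₁ + a₂ + j = l := by exact_mod_cast this
    omega
  · intro j e
    refine hCA j ?_
    have : (C : ℂ) + 2 * (l - k) + (n - 1) + 2 * (a₂ + a₃) = -2 * j := by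
      rw [rhoC] at e; linear_combination 2 * e
    exact_mod_cast this
  · intro j e
    refine hBA j ?_
    have : (B : ℂ) + 2 * (l - k) + (n - 1) + 2 * (a₁ + a₃) = -2 * j := by
      rw [rhoC] at e; linear_combination 2 * e
    exact_mod_cast this

theorem Ival_ne_zero_of_forall_ne_intCast {n k l : ℕ} (hkl : l < k) {α₁ α₂ α₃ : ℂ}
    (h₁ : ∀ B : ℤ, α₁ ≠ B) (h₁₂ : α₁ + α₂ = -2 * ((n : ℂ) - 1) - 2 * l)
    (h₃ : α₃ = 2 * ((l : ℂ) - k)) :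
    Ival n α₁ α₂ α₃ (l + 1) 0 0 ≠ 0 := by
  obtain rfl : α₂ = -2 * ((n : ℂ) - 1) - 2 * l - α₁ := by linear_combination h₁₂
  subst h₃
  apply Ival_ne_zero
  · intro j hj e
    have : k = j := by
      rw [rhoC] at e
      have : (k : ℂ) = j := by linear_combination -e
      exact_mod_cast this
    omega
  · intro j _ e
    refine h₁ (-2 * j - (n - 1)) ?_
    push_cast
    rw [rhoC] at e
    linear_combination 2 * e
  · simp
  · simp
  · intro j e
    have : ((j + 1 : ℕ) : ℂ) = 0 := by
      rw [rhoC] at e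
      push_cast at e ⊢
      linear_combination e
    exact Nat.cast_ne_zero.2 j.succ_ne_zero this
  · intro j e
    refine h₁ (2 * j - 2 * k) ?_
    rw [rhoC] at e
    push_cast at e ⊢
    linear_combination -2 * e
  · intro j e
    refine h₁ (-2 * j - 2 * (l - k) - 2 * (n - 1) - 2 * (l + 1)) ?_
    rw [rhoC] at e
    push_cast at e ⊢
    linear_combination 2 * e

/-- in the remaining case, either `α ∈ Z` or some `I_α(a₁,a₂,a₃)` is nonzero. -/
theorem memZ_or_exists_Ival_ne_zero (n : ℕ) (hn : 4 ≤ n) (k l : ℕ) (hkl : l < k)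
    (α₁ α₂ α₃ : ℂ)
    (hsum : α₁ + α₂ + α₃ = -2 * ((n : ℂ) - 1) - 2 * k)
    (h12 : α₁ + α₂ = -2 * ((n : ℂ) - 1) - 2 * l) :
    memZ n α₁ α₂ α₃ ∨ ∃ a₁ a₂ a₃ : ℕ, Ival n α₁ α₂ α₃ a₁ a₂ a₃ ≠ 0 := by
  have h3 : α₃ = 2 * ((l : ℂ) - k) := by linear_combination hsum - h12
  refine or_iff_not_imp_left.2 fun hZ => ?_
  by_cases hB : ∃ B : ℤ, α₁ = B
  · obtain ⟨B₀, hB₀⟩ := hB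
    obtain ⟨B, hB⟩ : ∃ B : ℤ, α₁ = B - ((n : ℂ) - 1) :=
      ⟨B₀ + (n - 1), by rw [hB₀]; push_cast; ring⟩
    have hC : α₂ = ((-2 * l - B : ℤ) : ℂ) - ((n : ℂ) - 1) := by
      push_cast
      linear_combination h12 - hB
    have neg_of_eq {D : ℤ} {x : ℂ} (hx : x = D - ((n : ℂ) - 1)) {i : ℕ} (hD : D = -2 * i) :
        ∃ k : ℕ, x = -((n : ℂ) - 1) - 2 * k := ⟨i, by rw [hx, hD]; push_cast; ring⟩
    have even_of_eq {D : ℤ} {x : ℂ} (hx : x = D - ((n : ℂ) - 1)) {i : ℕ}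
        (hD : D = (n : ℤ) - 1 + 2 * i) : ∃ l : ℕ, x = 2 * (l : ℂ) :=
      ⟨i, by rw [hx, hD]; push_cast; ring⟩
    have h3' : α₃ = (((n : ℤ) - 1 + 2 * ((l : ℤ) - k) : ℤ) : ℂ) - ((n : ℂ) - 1) := by
      rw [h3]; push_cast; ring
    obtain ⟨a₁, a₂, a₃, h⟩ := exists_isAdmissible (N := n - 1) (B := B) (C := -2 * l - B)
      (by omega) hkl (by ring)
      (fun j hj => hZ (.inr ⟨⟨k, hsum⟩, 0, even_of_eq hB hj⟩))
      (fun j hj => hZ (.inr ⟨⟨k, hsum⟩, 1, even_of_eq hC hj⟩))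
      (fun i j hi hj => hZ (.inl ⟨0, 1, by decide, neg_of_eq hB hi, neg_of_eq hC hj⟩))
      (fun i j hi hj => hZ (.inl ⟨0, 2, by decide, neg_of_eq hB hi, neg_of_eq h3' hj⟩))
      (fun i j hi hj => hZ (.inl ⟨1, 2, by decide, neg_of_eq hC hi, neg_of_eq h3' hj⟩))
    exact ⟨a₁, a₂, a₃, h.Ival_ne_zero (by ring) hB hC h3⟩
  · exact ⟨l + 1, 0, 0,
      Ival_ne_zero_of_forall_ne_intCast hkl (fun B h => hB ⟨B, h⟩) h12 h3⟩
end

section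
/- Let n ≥ 4, ρ = (n−1)/2, k ∈ ℕ, and let p, q be integers with 1 ≤ p, q ≤ k and p + q < k. Set λ₁ = −p and λ₂ = −q. Then every solution c of the system (S) satisfies c_{r,t} = 0 whenever 0 ≤ r ≤ p−1 or 0 ≤ t ≤ q−1. -/
/-- A solution of the system (S): a family `c_{r,t}` (indexed by `ℤ × ℤ`, vanishing outside
`{r ≥ 0, t ≥ 0, r + t ≤ k}`) satisfying the equations `E¹_{r,t}` and `E²_{r,t}`. -/
def IsSolS (n k : ℕ) (lam₁ lam₂ : ℂ) (c : ℤ → ℤ → ℂ) : Prop :=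
  (∀ r t : ℤ, (r < 0 ∨ t < 0 ∨ (k : ℤ) < r + t) → c r t = 0) ∧
  (∀ r t : ℤ, 0 ≤ r → 0 ≤ t → r + t ≤ (k : ℤ) →
    4 * ((r : ℂ) + 1) * ((r : ℂ) + 1 + lam₁) * c (r + 1) t +
      2 * ((k : ℂ) - r - t) * ((k : ℂ) - r + t - 1 + rhoC n + lam₂) * c r t -
      ((k : ℂ) - r - t + 1) * ((k : ℂ) - r - t) * c r (t - 1) = 0) ∧
  (∀ r t : ℤ, 0 ≤ r → 0 ≤ t → r + t ≤ (k : ℤ) →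
    4 * ((t : ℂ) + 1) * ((t : ℂ) + 1 + lam₂) * c r (t + 1) +
      2 * ((k : ℂ) - r - t) * ((k : ℂ) + r - t - 1 + rhoC n + lam₁) * c r t -
      ((k : ℂ) - r - t + 1) * ((k : ℂ) - r - t) * c (r - 1) t = 0)

lemma intCast_add_rhoC_ne_zero {n : ℕ} {m : ℤ} (hm : 1 ≤ m) : (m : ℂ) + rhoC n ≠ 0 := by
  intro h
  have h2 : 2 * m + n - 1 = 0 := by
    unfold rhoC at h
    exact_mod_cast (by linear_combination 2 * h : (2 * m + n - 1 : ℂ) = 0)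
  omega

/-- The system (S) is invariant under exchanging the two indices together with `λ₁` and `λ₂`. -/
lemma IsSolS.swap {n k : ℕ} {lam₁ lam₂ : ℂ} {c : ℤ → ℤ → ℂ} (hc : IsSolS n k lam₁ lam₂ c) :
    IsSolS n k lam₂ lam₁ (fun r t => c t r) := by
  obtain ⟨h0, h1, h2⟩ := hc
  refine ⟨fun r t h => h0 t r (by omega), fun r t hr ht h => ?_, fun r t hr ht h => ?_⟩
  · linear_combination h2 t r ht hr (by omega)
  · linear_combination h1 t r ht hr (by omega)

/-- Just before the degenerate index `r = p`, the column vanishes strictly inside the triangle. -/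
lemma IsSolS.eq_zero_pred {n k p q : ℕ} {c : ℤ → ℤ → ℂ} (hc : IsSolS n k (-(p : ℂ)) (-(q : ℂ)) c)
    (hp : 1 ≤ p) (hpq : p + q < k) {t : ℤ} (ht : 0 ≤ t) (htk : t ≤ k - p) :
    c (p - 1) t = 0 := by
  obtain ⟨h0, h1, -⟩ := hc
  induction t, ht using Int.leInduction with
  | base =>
    have e := h1 (p - 1) 0 (by omega) le_rfl (by omega)
    rw [h0 (p - 1) (0 - 1) (by omega)] at e
    have a : (((k : ℤ) - p + 1 : ℤ) : ℂ) ≠ 0 := Int.cast_ne_zero.mpr (by omega)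
    have b : (((k : ℤ) - p - q : ℤ) : ℂ) + rhoC n ≠ 0 := intCast_add_rhoC_ne_zero (by omega)
    refine (mul_eq_zero.mp ?_).resolve_left (mul_ne_zero a b)
    push_cast at e ⊢
    linear_combination e / 2
  | succ t ht ih =>
    have e := h1 (p - 1) (t + 1) (by omega) (by omega) (by omega)
    rw [add_sub_cancel_right t 1, ih (by omega)] at e
    have a : (((k : ℤ) - p - t : ℤ) : ℂ) ≠ 0 := Int.cast_ne_zero.mpr (by omega)
    have b : (((k : ℤ) - p - q + t + 1 : ℤ) : ℂ) + rhoC n ≠ 0 :=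
      intCast_add_rhoC_ne_zero (by omega)
    refine (mul_eq_zero.mp ?_).resolve_left (mul_ne_zero a b)
    push_cast at e ⊢
    linear_combination e / 2

lemma IsSolS.eq_zero_zero_left {n k p q : ℕ} {c : ℤ → ℤ → ℂ}
    (hc : IsSolS n k (-(p : ℂ)) (-(q : ℂ)) c) (hp : 1 ≤ p) (hq : 1 ≤ q) (hpq : p + q < k) (t : ℤ) :
    c 0 t = 0 := by
  have hrow : ∀ r : ℤ, 0 ≤ r → r ≤ k - q → c r (q - 1) = 0 := fun r hr hrk =>
    hc.swap.eq_zero_pred hq (by omega) hr hrk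
  have hcol : c (p - 1) q = 0 := hc.eq_zero_pred hp hpq (by omega) (by omega)
  obtain ⟨h0, h1, h2⟩ := hc
  have hdown : ∀ r : ℤ, r ≤ p - 1 → 0 ≤ r → c r q = 0 := by
    intro r hr
    induction r, hr using Int.leInductionDown with
    | base => exact fun _ => hcol
    | pred r hr ih =>
      intro hr0
      have e := h1 (r - 1) q hr0 (by omega) (by omega)
      rw [sub_add_cancel, ih (by omega), hrow (r - 1) hr0 (by omega)] at e
      have a : (((k : ℤ) - r + 1 - q : ℤ) : ℂ) ≠ 0 := Int.cast_ne_zero.mpr (by omega)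
      have b : (((k : ℤ) - r : ℤ) : ℂ) + rhoC n ≠ 0 := intCast_add_rhoC_ne_zero (by omega)
      refine (mul_eq_zero.mp ?_).resolve_left (mul_ne_zero a b)
      push_cast at e ⊢
      linear_combination e / 2
  have hlow : ∀ t : ℤ, t ≤ q - 1 → 0 ≤ t → c 0 t = 0 := by
    intro t ht
    induction t, ht using Int.leInductionDown with
    | base => exact fun _ => hrow 0 le_rfl (by omega)
    | pred t ht ih =>
      intro ht0
      have e := h2 0 (t - 1) le_rfl ht0 (by omega)
      rw [sub_add_cancel, ih (by omega), h0 (0 - 1) (t - 1) (by omega)] at e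
      have a : (((k : ℤ) - t + 1 : ℤ) : ℂ) ≠ 0 := Int.cast_ne_zero.mpr (by omega)
      have b : (((k : ℤ) - t - p : ℤ) : ℂ) + rhoC n ≠ 0 := intCast_add_rhoC_ne_zero (by omega)
      refine (mul_eq_zero.mp ?_).resolve_left (mul_ne_zero a b)
      push_cast at e ⊢
      linear_combination e / 2
  have hhigh : ∀ t : ℤ, (q : ℤ) ≤ t → c 0 t = 0 := by
    intro t ht
    induction t, ht using Int.leInduction with
    | base => exact hdown 0 (by omega) le_rfl
    | succ t ht ih =>
      by_cases htk : 0 + t ≤ (k : ℤ)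
      · have e := h2 0 t le_rfl (by omega) htk
        rw [ih, h0 (0 - 1) t (by omega)] at e
        have a : ((t + 1 : ℤ) : ℂ) ≠ 0 := Int.cast_ne_zero.mpr (by omega)
        have b : ((t + 1 - q : ℤ) : ℂ) ≠ 0 := Int.cast_ne_zero.mpr (by omega)
        refine (mul_eq_zero.mp ?_).resolve_left (mul_ne_zero a b)
        push_cast at e ⊢
        linear_combination e / 4
      · exact h0 _ _ (by omega)
  rcases lt_or_ge t 0 with h | h
  · exact h0 _ _ (by omega)
  rcases lt_or_ge t q with h' | h'
  · exact hlow t (by omega) h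
  · exact hhigh t h'

lemma IsSolS.eq_zero_of_lt {n k p q : ℕ} {c : ℤ → ℤ → ℂ}
    (hc : IsSolS n k (-(p : ℂ)) (-(q : ℂ)) c) (hp : 1 ≤ p) (hq : 1 ≤ q) (hpq : p + q < k)
    {r : ℤ} (hr : 0 ≤ r) (hrp : r < p) (t : ℤ) : c r t = 0 := by
  induction r, hr using Int.leInduction generalizing t with
  | base => exact hc.eq_zero_zero_left hp hq hpq t
  | succ r hr ih =>
    obtain ⟨h0, h1, -⟩ := hc
    by_cases h : 0 ≤ t ∧ r + t ≤ k
    · have e := h1 r t hr h.1 h.2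
      rw [ih (by omega) t, ih (by omega) (t - 1)] at e
      have a : ((r + 1 : ℤ) : ℂ) ≠ 0 := Int.cast_ne_zero.mpr (by omega)
      have b : ((r + 1 - p : ℤ) : ℂ) ≠ 0 := Int.cast_ne_zero.mpr (by omega)
      refine (mul_eq_zero.mp ?_).resolve_left (mul_ne_zero a b)
      push_cast at e ⊢
      linear_combination e / 4
    · exact h0 _ _ (by omega)

/-- for `λ₁ = -p`, `λ₂ = -q` with `1 ≤ p,q ≤ k` and `p + q < k`, every solution
of (S) satisfies `c_{r,t} = 0` whenever `0 ≤ r ≤ p-1` or `0 ≤ t ≤ q-1`. -/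
theorem solS_vanishing_strip_neg_int (n : ℕ) (hn : 4 ≤ n) (k p q : ℕ)
    (hp : 1 ≤ p) (hq : 1 ≤ q) (hpk : p ≤ k) (hqk : q ≤ k) (hpq : p + q < k)
    (c : ℤ → ℤ → ℂ) (hc : IsSolS n k (-(p : ℂ)) (-(q : ℂ)) c) :
    ∀ r t : ℤ, ((0 ≤ r ∧ r ≤ (p : ℤ) - 1) ∨ (0 ≤ t ∧ t ≤ (q : ℤ) - 1)) → c r t = 0 := by
  rintro r t (⟨h, h'⟩ | ⟨h, h'⟩)
  · exact hc.eq_zero_of_lt hp hq hpq h (by omega) t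
  · exact hc.swap.eq_zero_of_lt hq hp (by omega) h (by omega) r
end
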